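/- Let 0 ≤ ξ₁ < ξ₂ ≤ 1 and let F⁻¹_{U,[ξ₁,ξ₂]} = ∪_{ξ ∈ [ξ₁,ξ₂]} F⁻¹_{U,ξ}. For every measurable γ : (0,1) → ℝ with ∫₀¹ γ(u)² du < ∞ there exists γ_{ξ₁,ξ₂}↑ ∈ F⁻¹_{U,[ξ₁,ξ₂]} such that ‖γ − γ_{ξ₁,ξ₂}↑‖₂ = inf_{h ∈ F⁻¹_{U,[ξ₁,ξ₂]}} ‖γ − h‖₂, where ‖·‖₂ denotes the L²(0,1) norm; that is, the (possibly non-unique) L² projection of γ onto the non-convex set F⁻¹_{U,[ξ₁,ξ₂]} exists. -/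

import Mathlib

open MeasureTheory Set Filter

noncomputable section

/-- Left quantile function of a distribution function `G`. -/
def leftQ (G : ℝ → ℝ) (p : ℝ) : ℝ := sInf {x : ℝ | p ≤ G x}

/-- `G` is a cumulative distribution function. -/
def IsCDF (G : ℝ → ℝ) : Prop :=
  Monotone G ∧ (∀ x : ℝ, ContinuousWithinAt G (Ici x) x) ∧
    Tendsto G atBot (nhds 0) ∧ Tendsto G atTop (nhds 1)

/-- `G ∈ M²`: a cdf with finite second moment. -/
def MemM2 (G : ℝ → ℝ) : Prop :=
  IsCDF G ∧ IntegrableOn (fun t => (leftQ G t) ^ 2) (Ioo (0:ℝ) 1)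

/-- Mean of `f(V)` for `V` uniform on `(0,1)`. -/
def mean01 (f : ℝ → ℝ) : ℝ := ∫ t in Ioo (0:ℝ) 1, f t

/-- Variance of `f(V)` for `V` uniform on `(0,1)`. -/
def var01 (f : ℝ → ℝ) : ℝ := ∫ t in Ioo (0:ℝ) 1, (f t - mean01 f) ^ 2

/-- Covariance of `f(V)` and `h(V)` for `V` uniform on `(0,1)`. -/
def cov01 (f h : ℝ → ℝ) : ℝ := ∫ t in Ioo (0:ℝ) 1, (f t - mean01 f) * (h t - mean01 h)

/-- Pearson correlation of `f(V)` and `h(V)` for `V` uniform on `(0,1)`. -/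
def corr01 (f h : ℝ → ℝ) : ℝ := cov01 f h / (Real.sqrt (var01 f) * Real.sqrt (var01 h))

/-- Standard deviation of `f(V)` for `V` uniform on `(0,1)`. -/
def sd01 (f : ℝ → ℝ) : ℝ := Real.sqrt (var01 f)

/-- `L²(0,1)` norm. -/
def l2norm (f : ℝ → ℝ) : ℝ := Real.sqrt (∫ u in Ioo (0:ℝ) 1, (f u) ^ 2)

/-- Distortion risk metric expressed via the quantile function:
`ρ_g(h) = ∫₀¹ γ(u) h(u) du` where `γ` is the weight function of `g`. -/
def rhoQ (γ h : ℝ → ℝ) : ℝ := ∫ u in Ioo (0:ℝ) 1, γ u * h u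

/-- `h` belongs to `F⁻¹_{U,ξ}`: it is a quantile function of a unimodal distribution with
inflection point `ξ`, i.e. nondecreasing and continuous on `(0,1)`, concave on `(0,ξ)`,
convex on `(ξ,1)`, and square integrable on `(0,1)`. -/
def UQuant (ξ : ℝ) (h : ℝ → ℝ) : Prop :=
  MonotoneOn h (Ioo (0:ℝ) 1) ∧ ContinuousOn h (Ioo (0:ℝ) 1) ∧
    ConcaveOn ℝ (Ioo (0:ℝ) ξ) h ∧ ConvexOn ℝ (Ioo ξ 1) h ∧
    IntegrableOn (fun t => (h t) ^ 2) (Ioo (0:ℝ) 1)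

/-- `γp` is the `L²(0,1)`-projection of `γ` onto `F⁻¹_{U,ξ}`. -/
def IsProj (ξ : ℝ) (γ γp : ℝ → ℝ) : Prop :=
  UQuant ξ γp ∧ ∀ h : ℝ → ℝ, UQuant ξ h →
    (∫ u in Ioo (0:ℝ) 1, (γ u - γp u) ^ 2) ≤ ∫ u in Ioo (0:ℝ) 1, (γ u - h u) ^ 2

/-- `G ∈ F_{U,ξ}`: `G` is a unimodal cdf in `M²` with inflection point `ξ`. -/
def UnimodalCDF (ξ : ℝ) (G : ℝ → ℝ) : Prop :=
  MemM2 G ∧ ContinuousOn (leftQ G) (Ioo (0:ℝ) 1) ∧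
    ConcaveOn ℝ (Ioo (0:ℝ) ξ) (leftQ G) ∧ ConvexOn ℝ (Ioo ξ 1) (leftQ G)

/-- `F_{U,ξ}(μ,σ)`. -/
def FUset (ξ μ σ : ℝ) : Set (ℝ → ℝ) :=
  {G | UnimodalCDF ξ G ∧ mean01 (leftQ G) = μ ∧
    mean01 (fun t => (leftQ G t) ^ 2) = μ ^ 2 + σ ^ 2}

/-- `F_{U,ξ}(μ,σ,ε)`: additionally within 2-Wasserstein distance `√ε` of `F`. -/
def FUEset (ξ : ℝ) (F : ℝ → ℝ) (μ σ ε : ℝ) : Set (ℝ → ℝ) :=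
  {G | G ∈ FUset ξ μ σ ∧
    Real.sqrt (∫ t in Ioo (0:ℝ) 1, (leftQ F t - leftQ G t) ^ 2) ≤ Real.sqrt ε}

/-- `F_{U,[ξ₁,ξ₂]}(μ,σ)`: unimodal with some inflection point in `[ξ₁,ξ₂]`. -/
def FUIset (ξ₁ ξ₂ μ σ : ℝ) : Set (ℝ → ℝ) :=
  {G | (∃ ξ ∈ Icc ξ₁ ξ₂, UnimodalCDF ξ G) ∧ mean01 (leftQ G) = μ ∧
    mean01 (fun t => (leftQ G t) ^ 2) = μ ^ 2 + σ ^ 2}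

/-- `f` is constant on `(0,1)`. -/
def ConstOn01 (f : ℝ → ℝ) : Prop := ∃ c : ℝ, ∀ t ∈ Ioo (0:ℝ) 1, f t = c


theorem integrable_integral_le_of_tendsto {α : Type*} [MeasurableSpace α] {μ : Measure α}
    {f : ℕ → α → ℝ} {g : α → ℝ} {c : ℝ} (hf : ∀ n, Integrable (f n) μ)
    (hf0 : ∀ n x, 0 ≤ f n x)
    (hfg : ∀ᵐ x ∂μ, Tendsto (fun n => f n x) atTop (nhds (g x)))
    (hc : Tendsto (fun n => ∫ x, f n x ∂μ) atTop (nhds c)) :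
    Integrable g μ ∧ ∫ x, g x ∂μ ≤ c := by
  have hgm : AEStronglyMeasurable g μ :=
    aestronglyMeasurable_of_tendsto_ae _ (fun n => (hf n).aestronglyMeasurable) hfg
  have hg0 : 0 ≤ᵐ[μ] g := by
    filter_upwards [hfg] with x hx using ge_of_tendsto' hx fun n => hf0 n x
  have hc0 : 0 ≤ c := ge_of_tendsto' hc fun n => integral_nonneg (hf0 n)
  have hle : ∫⁻ x, ENNReal.ofReal (g x) ∂μ ≤ ENNReal.ofReal c := by
    calc ∫⁻ x, ENNReal.ofReal (g x) ∂μ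
        = ∫⁻ x, liminf (fun n => ENNReal.ofReal (f n x)) atTop ∂μ := by
          apply lintegral_congr_ae
          filter_upwards [hfg] with x hx
          exact (ENNReal.tendsto_ofReal hx).liminf_eq.symm
      _ ≤ liminf (fun n => ∫⁻ x, ENNReal.ofReal (f n x) ∂μ) atTop :=
          lintegral_liminf_le' fun n => (hf n).aestronglyMeasurable.aemeasurable.ennreal_ofReal
      _ = ENNReal.ofReal c := by
          simp_rw [← ofReal_integral_eq_lintegral_ofReal (hf _) (ae_of_all _ (hf0 _))]
          exact (ENNReal.tendsto_ofReal hc).liminf_eq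
  have hgi : Integrable g μ :=
    ⟨hgm, (hasFiniteIntegral_iff_ofReal hg0).2 (hle.trans_lt ENNReal.ofReal_lt_top)⟩
  refine ⟨hgi, ?_⟩
  rwa [← ofReal_integral_eq_lintegral_ofReal hgi hg0, ENNReal.ofReal_le_ofReal_iff hc0] at hle

/-- A sequence of functions on `(0,1)` that is pointwise bounded and locally equi-Lipschitz has a
pointwise convergent subsequence. -/
theorem exists_subseq_tendsto_of_locally_lipschitz {h : ℕ → ℝ → ℝ}
    (hB : ∀ x ∈ Ioo (0:ℝ) 1, ∃ B, ∀ n, |h n x| ≤ B)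
    (hL : ∀ a b : ℝ, 0 < a → b < 1 → ∃ L, ∀ n, ∀ x ∈ Icc a b, ∀ y ∈ Icc a b, x ≤ y →
      |h n y - h n x| ≤ L * (y - x)) :
    ∃ φ : ℕ → ℕ, StrictMono φ ∧ ∃ g : ℝ → ℝ, ∀ x ∈ Ioo (0:ℝ) 1,
      Tendsto (fun n => h (φ n) x) atTop (nhds (g x)) := by
  choose! B hB using hB
  let D := {q : ℚ // (q : ℝ) ∈ Ioo (0:ℝ) 1}
  have hK : IsCompact (univ.pi fun q : D => Icc (-B (q.1 : ℝ)) (B (q.1 : ℝ))) :=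
    isCompact_univ_pi fun _ => isCompact_Icc
  obtain ⟨v, -, φ, hφ, hv⟩ := hK.tendsto_subseq (x := fun n (q : D) => h n (q.1 : ℝ))
    fun n q _ => abs_le.1 (hB _ q.2 n)
  rw [tendsto_pi_nhds] at hv
  refine ⟨φ, hφ, ?_⟩
  have key : ∀ x ∈ Ioo (0:ℝ) 1, ∃ y, Tendsto (fun n => h (φ n) x) atTop (nhds y) := by
    intro x hx
    obtain ⟨L, hL⟩ := hL (x / 2) ((1 + x) / 2) (by linarith [hx.1]) (by linarith [hx.2])
    apply cauchySeq_tendsto_of_complete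
    rw [Metric.cauchySeq_iff']
    intro ε hε
    obtain ⟨q, hxq, hqx⟩ := exists_rat_btwn
      (show x < min ((1 + x) / 2) (x + ε / (3 * (|L| + 1))) from
        lt_min (by linarith [hx.2]) (by linarith [show 0 < ε / (3 * (|L| + 1)) by positivity]))
    rw [lt_min_iff] at hqx
    have hq : (q : ℝ) ∈ Ioo (0:ℝ) 1 := ⟨by linarith [hx.1], by linarith [hx.2]⟩
    have hclose : ∀ n, |h n q - h n x| < ε / 3 := by
      intro n
      have h1 := hL n x ⟨by linarith [hx.1], by linarith [hx.2]⟩ q ⟨by linarith [hx.1], hqx.1.le⟩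
        hxq.le
      have h2 : (q : ℝ) - x < ε / (3 * (|L| + 1)) := by linarith
      rw [lt_div_iff₀ (by positivity)] at h2
      have h3 : L * (q - x) ≤ |L| * (q - x) :=
        mul_le_mul_of_nonneg_right (le_abs_self L) (by linarith)
      nlinarith
    obtain ⟨N, hN⟩ := Metric.cauchySeq_iff'.1 (hv ⟨q, hq⟩).cauchySeq (ε / 3) (by positivity)
    refine ⟨N, fun n hn => ?_⟩
    have h1 := hN n hn
    simp only [Function.comp, Real.dist_eq] at h1 ⊢
    have h2 := abs_lt.1 (hclose (φ n))
    have h3 := abs_lt.1 (hclose (φ N))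
    have h4 := abs_lt.1 h1
    rw [abs_lt]
    constructor <;> linarith
  choose! g hg using key
  exact ⟨g, hg⟩

theorem sub_le_mul_of_forall_Ioo {f : ℝ → ℝ} {x y L : ℝ} (hxy : x ≤ y)
    (hf : ContinuousOn f (Icc x y))
    (hfL : ∀ s ∈ Ioo x y, ∀ t ∈ Ioo x y, s < t → f t - f s ≤ L * (t - s)) :
    f y - f x ≤ L * (y - x) := by
  rcases hxy.eq_or_lt with rfl | hxy
  · simp
  have hbot : ∀ t ∈ Ioo x y, f t - f x ≤ L * (t - x) := by
    intro t ht
    have hx : Tendsto f (nhdsWithin x (Ioi x)) (nhds (f x)) :=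
      ((hf x (left_mem_Icc.2 hxy.le)).mono_left
        (nhdsWithin_le_of_mem (Icc_mem_nhdsGT hxy)))
    have hid : Tendsto (fun s : ℝ => s) (nhdsWithin x (Ioi x)) (nhds x) := nhdsWithin_le_nhds
    refine le_of_tendsto_of_tendsto (hx.const_sub (f t)) ((hid.const_sub t).const_mul L) ?_
    filter_upwards [Ioo_mem_nhdsGT ht.1] with s hs
    exact hfL s ⟨hs.1, hs.2.trans ht.2⟩ t ht hs.2
  have hy : Tendsto f (nhdsWithin y (Iio y)) (nhds (f y)) :=
    ((hf y (right_mem_Icc.2 hxy.le)).mono_left (nhdsWithin_le_of_mem (Icc_mem_nhdsLT hxy)))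
  have hid : Tendsto (fun s : ℝ => s) (nhdsWithin y (Iio y)) (nhds y) := nhdsWithin_le_nhds
  refine le_of_tendsto_of_tendsto (hy.sub_const (f x)) ((hid.sub_const x).const_mul L) ?_
  filter_upwards [Ioo_mem_nhdsLT hxy] with s hs using hbot s hs

theorem UQuant.sq_mul_le {ξ : ℝ} {h : ℝ → ℝ} (hh : UQuant ξ h) {p : ℝ}
    (hp : p ∈ Ioo (0:ℝ) 1) :
    h p ^ 2 * (p * (1 - p)) ≤ ∫ u in Ioo (0:ℝ) 1, h u ^ 2 := by
  obtain ⟨hmono, -, -, -, hint⟩ := hh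
  have main : ∀ a b : ℝ, 0 ≤ a → a < b → b ≤ 1 → (∀ u ∈ Ioo a b, h p ^ 2 ≤ h u ^ 2) →
      h p ^ 2 * (b - a) ≤ ∫ u in Ioo (0:ℝ) 1, h u ^ 2 := by
    intro a b ha hab hb hle
    have hsub : Ioo a b ⊆ Ioo (0:ℝ) 1 := Ioo_subset_Ioo ha hb
    have h1 := setIntegral_ge_of_const_le_real (μ := volume) measurableSet_Ioo (by simp) hle
      (hint.mono_set hsub)
    rw [Real.volume_real_Ioo_of_le hab.le] at h1
    exact h1.trans (setIntegral_mono_set hint (ae_of_all _ fun u => sq_nonneg (h u))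
      hsub.eventuallyLE)
  have hp0 := hp.1
  have hp1 := hp.2
  rcases le_total 0 (h p) with h0 | h0
  · have h1 := main p 1 hp.1.le hp.2 le_rfl fun u hu =>
      pow_le_pow_left₀ h0 (hmono hp ⟨hp.1.trans hu.1, hu.2⟩ hu.1.le) 2
    nlinarith [mul_nonneg (mul_nonneg (sq_nonneg (h p)) (sub_nonneg.2 hp1.le))
      (sub_nonneg.2 hp1.le)]
  · have h1 := main 0 p le_rfl hp.1 hp.2.le fun u hu => by
      have := hmono ⟨hu.1, hu.2.trans hp.2⟩ hp hu.2.le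
      nlinarith
    nlinarith [mul_nonneg (mul_nonneg (sq_nonneg (h p)) hp0.le) hp0.le]

theorem UQuant.exists_abs_le (M : ℝ) {x : ℝ} (hx : x ∈ Ioo (0:ℝ) 1) :
    ∃ B, 0 ≤ B ∧ ∀ ξ h, UQuant ξ h → ∫ u in Ioo (0:ℝ) 1, h u ^ 2 ≤ M → |h x| ≤ B := by
  refine ⟨√(M / (x * (1 - x))), Real.sqrt_nonneg _, fun ξ h hh hM => ?_⟩
  apply Real.abs_le_sqrt
  rw [le_div_iff₀ (mul_pos hx.1 (sub_pos.2 hx.2))]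
  exact (hh.sq_mul_le hx).trans hM

theorem UQuant.exists_lipschitz (M : ℝ) {a b : ℝ} (ha : 0 < a) (hb : b < 1) :
    ∃ L, ∀ ξ h, UQuant ξ h → ∫ u in Ioo (0:ℝ) 1, h u ^ 2 ≤ M →
      ∀ x ∈ Icc a b, ∀ y ∈ Icc a b, x ≤ y → |h y - h x| ≤ L * (y - x) := by
  by_cases hab : a ≤ b
  swap
  · exact ⟨0, fun ξ h _ _ x hx => absurd (hx.1.trans hx.2) hab⟩
  have hc : a / 2 ∈ Ioo (0:ℝ) 1 := ⟨by linarith, by linarith⟩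
  have hd : (1 + b) / 2 ∈ Ioo (0:ℝ) 1 := ⟨by linarith, by linarith⟩
  obtain ⟨B, hB0, hB⟩ := UQuant.exists_abs_le M hc
  obtain ⟨C, hC0, hC⟩ := UQuant.exists_abs_le M hd
  set L := (B + C) / (a / 2) + (B + C) / ((1 - b) / 2)
  have hL1 : (B + C) / (a / 2) ≤ L :=
    le_add_of_nonneg_right (div_nonneg (by positivity) (by linarith))
  have hL2 : (B + C) / ((1 - b) / 2) ≤ L := le_add_of_nonneg_left (by positivity)
  refine ⟨L, fun ξ h hh hM x hx y hy hxy => ?_⟩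
  have hBh := abs_le.1 (hB ξ h hh hM)
  have hCh := abs_le.1 (hC ξ h hh hM)
  obtain ⟨hmono, hcont, hconc, hconv, -⟩ := hh
  have hmem : ∀ {s}, s ∈ Icc a b → s ∈ Ioo (0:ℝ) 1 := fun hs =>
    ⟨ha.trans_le hs.1, hs.2.trans_lt hb⟩
  rw [abs_of_nonneg (sub_nonneg.2 (hmono (hmem hx) (hmem hy) hxy))]
  have hleft : ∀ s ∈ Icc a b, ∀ t ∈ Icc a b, s ≤ t → t ≤ ξ → h t - h s ≤ L * (t - s) := by
    intro s hs t ht hst htξ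
    refine sub_le_mul_of_forall_Ioo hst
      (hcont.mono fun u hu => hmem ⟨hs.1.trans hu.1, hu.2.trans ht.2⟩) fun u hu v hv huv => ?_
    have hau : a / 2 < u := by linarith [hs.1, hu.1]
    have h1 := hconc.slope_anti_adjacent (x := a / 2) (y := u) (z := v)
      ⟨hc.1, by linarith [hu.2]⟩ ⟨by linarith [hs.1, hv.1], by linarith [hv.2]⟩ hau huv
    have hud : h u ≤ h ((1 + b) / 2) :=
      hmono (hmem ⟨by linarith [hs.1, hu.1], by linarith [ht.2, hu.2]⟩) hd
        (by linarith [ht.2, hu.2])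
    have h2 : (h u - h (a / 2)) / (u - a / 2) ≤ (B + C) / (a / 2) :=
      div_le_div₀ (by positivity) (by linarith) (by positivity) (by linarith [hs.1, hu.1])
    exact (div_le_iff₀ (sub_pos.2 huv)).1 ((h1.trans h2).trans hL1)
  have hright : ∀ s ∈ Icc a b, ∀ t ∈ Icc a b, s ≤ t → ξ ≤ s → h t - h s ≤ L * (t - s) := by
    intro s hs t ht hst hξs
    refine sub_le_mul_of_forall_Ioo hst
      (hcont.mono fun u hu => hmem ⟨hs.1.trans hu.1, hu.2.trans ht.2⟩) fun u hu v hv huv => ?_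
    have hvb : v < (1 + b) / 2 := by linarith [ht.2, hv.2]
    have h1 := hconv.slope_mono_adjacent (x := u) (y := v) (z := (1 + b) / 2)
      ⟨by linarith [hu.1], by linarith [ht.2, hu.2]⟩ ⟨by linarith [hv.1], hd.2⟩ huv hvb
    have hcv : h (a / 2) ≤ h v :=
      hmono hc (hmem ⟨by linarith [hs.1, hv.1], by linarith [ht.2, hv.2]⟩)
        (by linarith [hs.1, hv.1])
    have h2 : (h ((1 + b) / 2) - h v) / ((1 + b) / 2 - v) ≤ (B + C) / ((1 - b) / 2) :=
      div_le_div₀ (by positivity) (by linarith) (by linarith) (by linarith [ht.2, hv.2])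
    exact (div_le_iff₀ (sub_pos.2 huv)).1 ((h1.trans h2).trans hL2)
  rcases le_total y ξ with hyξ | hξy
  · exact hleft x hx y hy hxy hyξ
  rcases le_total ξ x with hξx | hxξ
  · exact hright x hx y hy hxy hξx
  have hξ : ξ ∈ Icc a b := ⟨hx.1.trans hxξ, hξy.trans hy.2⟩
  linarith [hleft x hx ξ hξ hxξ le_rfl, hright ξ hξ y hy hξy le_rfl]

theorem UQuant.memLp {ξ : ℝ} {h : ℝ → ℝ} (hh : UQuant ξ h) :
    MemLp h 2 (volume.restrict (Ioo (0:ℝ) 1)) :=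
  (memLp_two_iff_integrable_sq
    (hh.2.1.aestronglyMeasurable measurableSet_Ioo)).2 hh.2.2.2.2

theorem UQuant.of_tendsto {ξ : ℝ} {ξs : ℕ → ℝ} {h : ℕ → ℝ → ℝ} {g : ℝ → ℝ}
    (hξ0 : 0 ≤ ξ) (hξ1 : ξ ≤ 1) (hξ : Tendsto ξs atTop (nhds ξ)) (hh : ∀ n, UQuant (ξs n) (h n))
    {M : ℝ} (hM : ∀ n, ∫ u in Ioo (0:ℝ) 1, h n u ^ 2 ≤ M)
    (hg : ∀ x ∈ Ioo (0:ℝ) 1, Tendsto (fun n => h n x) atTop (nhds (g x)))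
    (hgi : IntegrableOn (fun t => g t ^ 2) (Ioo (0:ℝ) 1)) : UQuant ξ g := by
  refine ⟨?_, ?_, ⟨convex_Ioo _ _, ?_⟩, ⟨convex_Ioo _ _, ?_⟩, hgi⟩
  · exact fun x hx y hy hxy => le_of_tendsto_of_tendsto' (hg x hx) (hg y hy)
      fun n => (hh n).1 hx hy hxy
  · intro x hx
    obtain ⟨L, hL⟩ := UQuant.exists_lipschitz M (a := x / 2) (b := (1 + x) / 2)
      (by linarith [hx.1]) (by linarith [hx.2])
    have hlip : LipschitzOnWith (Real.toNNReal L) g (Icc (x / 2) ((1 + x) / 2)) := by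
      have hmem : ∀ {s}, s ∈ Icc (x / 2) ((1 + x) / 2) → s ∈ Ioo (0:ℝ) 1 := fun hs =>
        ⟨by linarith [hx.1, hs.1], by linarith [hx.2, hs.2]⟩
      have hle : ∀ s ∈ Icc (x / 2) ((1 + x) / 2), ∀ t ∈ Icc (x / 2) ((1 + x) / 2), s ≤ t →
          |g t - g s| ≤ L * (t - s) := fun s hs t ht hst =>
        le_of_tendsto' ((hg t (hmem ht)).sub (hg s (hmem hs))).abs
          fun n => hL _ _ (hh n) (hM n) s hs t ht hst
      refine LipschitzOnWith.of_dist_le_mul fun s hs t ht => ?_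
      rw [Real.dist_eq, Real.dist_eq]
      refine le_trans ?_ (mul_le_mul_of_nonneg_right (Real.le_coe_toNNReal L) (abs_nonneg _))
      rcases le_total s t with hst | hst
      · rw [abs_sub_comm, abs_sub_comm s, abs_of_nonneg (sub_nonneg.2 hst)]
        exact hle s hs t ht hst
      · rw [abs_of_nonneg (sub_nonneg.2 hst)]
        exact hle t ht s hs hst
    exact (hlip.continuousOn.continuousAt
      (Icc_mem_nhds (by linarith [hx.1]) (by linarith [hx.2]))).continuousWithinAt
  · intro x hx y hy s t hs ht hst
    have hz := convex_Ioo 0 ξ hx hy hs ht hst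
    have hsub : Ioo 0 ξ ⊆ Ioo (0:ℝ) 1 := Ioo_subset_Ioo_right hξ1
    refine le_of_tendsto_of_tendsto
      (((hg x (hsub hx)).const_smul s).add ((hg y (hsub hy)).const_smul t)) (hg _ (hsub hz)) ?_
    filter_upwards [hξ.eventually (lt_mem_nhds hx.2), hξ.eventually (lt_mem_nhds hy.2)]
      with n hxn hyn using (hh n).2.2.1.2 ⟨hx.1, hxn⟩ ⟨hy.1, hyn⟩ hs ht hst
  · intro x hx y hy s t hs ht hst
    have hz := convex_Ioo ξ 1 hx hy hs ht hst
    have hsub : Ioo ξ 1 ⊆ Ioo (0:ℝ) 1 := Ioo_subset_Ioo_left hξ0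
    refine le_of_tendsto_of_tendsto (hg _ (hsub hz))
      (((hg x (hsub hx)).const_smul s).add ((hg y (hsub hy)).const_smul t)) ?_
    filter_upwards [hξ.eventually (gt_mem_nhds hx.1), hξ.eventually (gt_mem_nhds hy.1)]
      with n hxn hyn using (hh n).2.2.2.1.2 ⟨hxn, hx.2⟩ ⟨hyn, hy.2⟩ hs ht hst

theorem stmt_18 (ξ₁ ξ₂ : ℝ) (h₁ : 0 ≤ ξ₁) (h₂ : ξ₁ < ξ₂) (h₃ : ξ₂ ≤ 1)
    (γ : ℝ → ℝ) (hmeas : Measurable γ)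
    (hγ2 : IntegrableOn (fun u => (γ u) ^ 2) (Ioo (0:ℝ) 1)) :
    ∃ γp : ℝ → ℝ, (∃ ξ ∈ Icc ξ₁ ξ₂, UQuant ξ γp) ∧
      ∀ h : ℝ → ℝ, (∃ ξ ∈ Icc ξ₁ ξ₂, UQuant ξ h) →
        (∫ u in Ioo (0:ℝ) 1, (γ u - γp u) ^ 2)
          ≤ ∫ u in Ioo (0:ℝ) 1, (γ u - h u) ^ 2 := by
  set μ := volume.restrict (Ioo (0:ℝ) 1)
  have hγ : MemLp γ 2 μ := (memLp_two_iff_integrable_sq hmeas.aestronglyMeasurable).2 hγ2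
  set S : Set ℝ := {r | ∃ h : ℝ → ℝ, (∃ ξ ∈ Icc ξ₁ ξ₂, UQuant ξ h) ∧
    r = ∫ u in Ioo (0:ℝ) 1, (γ u - h u) ^ 2}
  have hSne : S.Nonempty := by
    refine ⟨_, fun _ => 0, ⟨ξ₁, left_mem_Icc.2 h₂.le, ?_⟩, rfl⟩
    exact ⟨fun _ _ _ _ _ => le_rfl, continuousOn_const, concaveOn_const _ (convex_Ioo _ _),
      convexOn_const _ (convex_Ioo _ _), by simp⟩
  have hSb : BddBelow S := by
    refine ⟨0, ?_⟩
    rintro r ⟨h, -, rfl⟩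
    exact integral_nonneg fun u => sq_nonneg _
  obtain ⟨r, -, hr, hrS⟩ := exists_seq_tendsto_sInf hSne hSb
  choose h hξ hrh using hrS
  choose ξs hξs hh using hξ
  have hdiff : ∀ n, Integrable (fun u => (γ u - h n u) ^ 2) μ := fun n =>
    (hγ.sub (hh n).memLp).integrable_sq
  obtain ⟨C, hC⟩ := hr.bddAbove_range
  have hM : ∀ n, ∫ u in Ioo (0:ℝ) 1, h n u ^ 2
      ≤ 2 * (∫ u in Ioo (0:ℝ) 1, γ u ^ 2) + 2 * C := by
    intro n
    have h1 : ∫ u in Ioo (0:ℝ) 1, h n u ^ 2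
        ≤ ∫ u in Ioo (0:ℝ) 1, (2 * γ u ^ 2 + 2 * (γ u - h n u) ^ 2) :=
      integral_mono (hh n).2.2.2.2 ((hγ2.const_mul 2).add ((hdiff n).const_mul 2))
        fun u => by
          dsimp only
          nlinarith [sq_nonneg (2 * γ u - h n u)]
    rw [integral_add (hγ2.const_mul 2) ((hdiff n).const_mul 2), integral_const_mul,
      integral_const_mul, ← hrh n] at h1
    linarith [hC (mem_range_self n)]
  obtain ⟨ξ, hξ, ψ, hψ, hξψ⟩ := isCompact_Icc.tendsto_subseq hξs
  obtain ⟨φ, hφ, g, hg⟩ := exists_subseq_tendsto_of_locally_lipschitz (h := fun n => h (ψ n))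
    (fun x hx => by
      obtain ⟨B, -, hB⟩ := UQuant.exists_abs_le
        (2 * (∫ u in Ioo (0:ℝ) 1, γ u ^ 2) + 2 * C) hx
      exact ⟨B, fun n => hB _ _ (hh _) (hM _)⟩)
    (fun a b ha hb => by
      obtain ⟨L, hL⟩ := UQuant.exists_lipschitz
        (2 * (∫ u in Ioo (0:ℝ) 1, γ u ^ 2) + 2 * C) ha hb
      exact ⟨L, fun n => hL _ _ (hh _) (hM _)⟩)
  have hgae : ∀ᵐ x ∂μ, Tendsto (fun n => h (ψ (φ n)) x) atTop (nhds (g x)) :=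
    (ae_restrict_iff' measurableSet_Ioo).2 (ae_of_all _ hg)
  have hgm : AEStronglyMeasurable g μ :=
    aestronglyMeasurable_of_tendsto_ae _ (fun n => (hh (ψ (φ n))).memLp.1) hgae
  obtain ⟨hgi, hgle⟩ := integrable_integral_le_of_tendsto (μ := μ) (c := sInf S)
    (f := fun n u => (γ u - h (ψ (φ n)) u) ^ 2) (g := fun u => (γ u - g u) ^ 2)
    (fun n => hdiff _) (fun n u => sq_nonneg _)
    (by filter_upwards [hgae] with x hx using (hx.const_sub (γ x)).pow 2)
    (by
      simp_rw [μ, ← hrh]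
      exact hr.comp (hψ.comp hφ).tendsto_atTop)
  have hg2 : MemLp g 2 μ := by
    have h1 := hγ.sub ((memLp_two_iff_integrable_sq
      (hmeas.aestronglyMeasurable.sub hgm)).2 hgi)
    simpa using h1
  refine ⟨g, ⟨ξ, hξ, UQuant.of_tendsto (h₁.trans hξ.1) (hξ.2.trans h₃)
    (hξψ.comp hφ.tendsto_atTop) (fun n => hh _) (fun n => hM _) hg hg2.integrable_sq⟩,
    fun k hk => hgle.trans (csInf_le hSb ⟨k, hk, rfl⟩)⟩

end
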